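/- arXiv:1311.0514 — 3 statements merged into one kernel-verified Lean document; each statement's English description precedes it below -/
import Mathlib

section
/- The R-algebra homomorphism Φ : A ⊗_R A → A × A determined on pure tensors by Φ(x ⊗ y) = (x·y, x·g(y)) is surjective. (Explicitly, Φ((1/2)⊗1 + (1/2)t⁻¹⊗t) = (1,0) and Φ((1/2)⊗1 − (1/2)t⁻¹⊗t) = (0,1), and Φ is A-linear for the left A-module structures.) -/
open LaurentPolynomial

/-- `R = ℤ[1/2]`, the subring of `ℚ` generated by `1/2` (the localization of `ℤ` away
from `2`). -/
def Rhalf : Type := Subring.closure {(2 : ℚ)⁻¹}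

noncomputable instance : CommRing Rhalf :=
  inferInstanceAs (CommRing (Subring.closure {(2 : ℚ)⁻¹}))

/-- `A = R[t, t⁻¹]`, the Laurent polynomial ring over `R = ℤ[1/2]`. -/
noncomputable abbrev Ahalf : Type := LaurentPolynomial Rhalf

open scoped TensorProduct

/-- `2` is invertible in `ℤ[1/2]`. -/
lemma Rhalf.exists_add_self_eq_one : ∃ c : Rhalf, c + c = 1 :=
  ⟨(⟨2⁻¹, Subring.subset_closure rfl⟩ : Subring.closure {(2 : ℚ)⁻¹}),
    Subtype.ext (by change (2 : ℚ)⁻¹ + 2⁻¹ = 1; norm_num)⟩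

/-- The `R`-algebra homomorphism `Φ : A ⊗[R] A → A × A` determined on pure tensors by
`Φ (x ⊗ y) = (x * y, x * g y)`, where `g` is the unique `R`-algebra automorphism of `A`
sending `t` to `-t`, is surjective. -/
theorem stmt0 (g : Ahalf ≃ₐ[Rhalf] Ahalf) (hg : g (T 1) = - T 1) :
    Function.Surjective
      (Algebra.TensorProduct.productMap (R := Rhalf) (S := Ahalf × Ahalf)
        ((AlgHom.id Rhalf Ahalf).prod (AlgHom.id Rhalf Ahalf))
        ((AlgHom.id Rhalf Ahalf).prod g.toAlgHom)) := by
  rintro ⟨a, b⟩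
  obtain ⟨c, hc⟩ := Rhalf.exists_add_self_eq_one
  have hC : (C c : Ahalf) + C c = 1 := by rw [← map_add, hc, map_one]
  have hT : (T (-1) : Ahalf) * T 1 = 1 := by rw [← T_add, neg_add_cancel, T_zero]
  refine ⟨((a + b) * C c) ⊗ₜ[Rhalf] 1 + ((a - b) * C c * T (-1)) ⊗ₜ[Rhalf] T 1, ?_⟩
  rw [map_add, Algebra.TensorProduct.productMap_apply_tmul,
    Algebra.TensorProduct.productMap_apply_tmul]
  refine Prod.ext ?_ ?_
  · change (a + b) * C c * 1 + (a - b) * C c * T (-1) * T 1 = a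
    linear_combination a * hC + (a - b) * C c * hT
  · change (a + b) * C c * g 1 + (a - b) * C c * T (-1) * g (T 1) = b
    rw [map_one, hg]
    linear_combination b * hC - (a - b) * C c * hT
end

section
/- Let I be a set, k a natural number, and f : Fin (k+1) → I any function. Then there exist a unique natural number m ≤ k, a unique monotone surjection σ : Fin (k+1) → Fin (m+1), and a unique function h : Fin (m+1) → I satisfying h(j) ≠ h(j+1) for every j with j+1 ≤ m (no two consecutive values of h are equal), such that f = h ∘ σ. (This expresses that every tuple factors uniquely as an order-preserving surjection followed by a nondegenerate tuple; it is the statement that the unordered Čech simplicial object has free degeneracies.) -/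
open Classical in
theorem Nat.exists_lt_count_eq {p : ℕ → Prop} {j n : ℕ} (h : j < Nat.count p n) :
    ∃ i < n, p i ∧ Nat.count p i = j := by
  induction n with
  | zero => simp at h
  | succ n ih =>
    by_cases hj : j < Nat.count p n
    · obtain ⟨i, hi, hp⟩ := ih hj
      exact ⟨i, by omega, hp⟩
    · rw [Nat.count_succ] at h
      split_ifs at h with hp
      · exact ⟨n, by omega, hp, by omega⟩
      · omega

/-- The tuple `f` changes value between positions `n` and `n + 1`. -/
def IsJump {I : Type*} {k : ℕ} (f : Fin (k + 1) → I) (n : ℕ) : Prop :=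
  ∃ h : n < k, f ⟨n, by omega⟩ ≠ f ⟨n + 1, by omega⟩

open Classical in
/-- The number of value changes of the tuple `f` before position `n`. -/
noncomputable def jumpCount {I : Type*} {k : ℕ} (f : Fin (k + 1) → I) (n : ℕ) : ℕ :=
  Nat.count (IsJump f) n

open Classical in
theorem jumpCount_mono {I : Type*} {k : ℕ} (f : Fin (k + 1) → I) : Monotone (jumpCount f) :=
  Nat.count_monotone _

theorem jumpCount_succ_of_isJump {I : Type*} {k : ℕ} {f : Fin (k + 1) → I} {n : ℕ}
    (h : IsJump f n) : jumpCount f (n + 1) = jumpCount f n + 1 := by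
  simp [jumpCount, Nat.count_succ, h]

theorem jumpCount_succ_of_not_isJump {I : Type*} {k : ℕ} {f : Fin (k + 1) → I} {n : ℕ}
    (h : ¬IsJump f n) : jumpCount f (n + 1) = jumpCount f n := by
  simp [jumpCount, Nat.count_succ, h]

theorem apply_eq_of_jumpCount_eq_of_le {I : Type*} {k : ℕ} (f : Fin (k + 1) → I) {a b : ℕ}
    (hab : a ≤ b) (hb : b < k + 1) (h : jumpCount f a = jumpCount f b) :
    f ⟨a, by omega⟩ = f ⟨b, hb⟩ := by
  induction b, hab using Nat.le_induction with
  | base => rfl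
  | succ b hab ih =>
    have h₁ := jumpCount_mono f hab
    have h₂ := jumpCount_mono f (Nat.le_succ b)
    have hj : ¬IsJump f b := fun hj ↦ by
      have := jumpCount_succ_of_isJump hj
      omega
    rw [ih (by omega) (by simp only [Nat.succ_eq_add_one] at h₂; omega)]
    by_contra hne
    exact hj ⟨by omega, hne⟩

theorem apply_eq_of_jumpCount_eq {I : Type*} {k : ℕ} (f : Fin (k + 1) → I) {a b : Fin (k + 1)}
    (h : jumpCount f a = jumpCount f b) : f a = f b := by
  rcases le_total a b with hab | hab
  · exact apply_eq_of_jumpCount_eq_of_le f hab b.2 h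
  · exact (apply_eq_of_jumpCount_eq_of_le f hab a.2 h.symm).symm

/-- In a factorization of `f` as a monotone surjection followed by a nondegenerate tuple, the
surjection counts the value changes of `f`. -/
theorem val_eq_jumpCount {I : Type*} {k m : ℕ} {f : Fin (k + 1) → I}
    {σ : Fin (k + 1) → Fin (m + 1)} {h : Fin (m + 1) → I} (hσ : Monotone σ)
    (hs : Function.Surjective σ) (hh : ∀ j : Fin m, h j.castSucc ≠ h j.succ) (hf : f = h ∘ σ)
    (n : ℕ) (hn : n < k + 1) : (σ ⟨n, hn⟩ : ℕ) = jumpCount f n := by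
  induction n with
  | zero =>
    obtain ⟨a, ha⟩ := hs 0
    have h0 : σ ⟨0, hn⟩ ≤ σ a := hσ (Fin.zero_le a)
    rw [ha] at h0
    simpa [jumpCount] using h0
  | succ n ih =>
    have ih := ih (by omega)
    have hle : (σ ⟨n, by omega⟩ : ℕ) ≤ σ ⟨n + 1, hn⟩ :=
      hσ (Fin.mk_le_mk.2 (Nat.le_succ n))
    have hle' : (σ ⟨n + 1, hn⟩ : ℕ) ≤ (σ ⟨n, by omega⟩ : ℕ) + 1 := by
      by_contra! hlt
      obtain ⟨a, ha⟩ := hs ⟨(σ ⟨n, by omega⟩ : ℕ) + 1, by omega⟩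
      have hav := congrArg Fin.val ha
      simp only at hav
      rcases Nat.lt_or_ge n a with han | han
      · have : (σ ⟨n + 1, hn⟩ : ℕ) ≤ σ a := hσ (Fin.mk_le_of_le_val han)
        omega
      · have : (σ a : ℕ) ≤ σ ⟨n, by omega⟩ := hσ (Fin.le_def.2 han)
        omega
    by_cases hj : IsJump f n
    · rw [jumpCount_succ_of_isJump hj]
      obtain ⟨_, hne⟩ := hj
      have : (σ ⟨n, by omega⟩ : ℕ) ≠ σ ⟨n + 1, hn⟩ := fun he ↦
        hne (by rw [hf]; exact congrArg h (Fin.ext he))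
      omega
    · rw [jumpCount_succ_of_not_isJump hj]
      by_contra hne
      have hlt := (σ ⟨n + 1, hn⟩).2
      refine hj ⟨by omega, fun he ↦ hh ⟨(σ ⟨n, by omega⟩ : ℕ), by omega⟩ ?_⟩
      have hsucc : Fin.succ ⟨(σ ⟨n, by omega⟩ : ℕ), by omega⟩ = σ ⟨n + 1, hn⟩ :=
        Fin.ext (by simp only [Fin.val_succ]; omega)
      rw [hsucc]
      rw [hf] at he
      exact he

/-- Every tuple `f : Fin (k+1) → I` factors uniquely as an order-preserving surjection
`σ : Fin (k+1) → Fin (m+1)` (with `m ≤ k`) followed by a nondegenerate tuple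
`h : Fin (m+1) → I`, i.e. one in which no two consecutive values are equal.  (This is the
statement that the unordered Čech simplicial object has free degeneracies.) -/
theorem stmt5 {I : Type*} (k : ℕ) (f : Fin (k + 1) → I) :
    ∃! p : (m : ℕ) × (Fin (k + 1) → Fin (m + 1)) × (Fin (m + 1) → I),
      p.1 ≤ k ∧ Monotone p.2.1 ∧ Function.Surjective p.2.1 ∧
        (∀ j : Fin p.1, p.2.2 j.castSucc ≠ p.2.2 j.succ) ∧ f = p.2.2 ∘ p.2.1 := by
  apply existsUnique_of_exists_of_unique
  · let σ : Fin (k + 1) → Fin (jumpCount f k + 1) := fun i ↦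
      ⟨jumpCount f i, Nat.lt_succ_of_le (jumpCount_mono f (Nat.le_of_lt_succ i.2))⟩
    have jump (j : ℕ) (hj : j < jumpCount f k) : ∃ i < k, IsJump f i ∧ jumpCount f i = j :=
      Nat.exists_lt_count_eq hj
    have hs : Function.Surjective σ := by
      rintro ⟨_ | j, hj⟩
      · exact ⟨0, Fin.ext (by simp [σ, jumpCount])⟩
      · obtain ⟨i, hi, hp, hc⟩ := jump j (by omega)
        exact ⟨⟨i + 1, by omega⟩, Fin.ext (by simp [σ, jumpCount_succ_of_isJump hp, hc])⟩
    have hfac (i : Fin (k + 1)) : f (Function.surjInv hs (σ i)) = f i :=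
      apply_eq_of_jumpCount_eq f (congrArg Fin.val (Function.surjInv_eq hs (σ i)))
    refine ⟨⟨jumpCount f k, σ, f ∘ Function.surjInv hs⟩, ?_, ?_, hs, ?_, ?_⟩
    · classical exact Nat.count_le _
    · exact fun a b hab ↦ jumpCount_mono f hab
    · intro j
      obtain ⟨i, hi, hp, hc⟩ := jump j j.2
      have h₁ : j.castSucc = σ ⟨i, by omega⟩ := Fin.ext (by simp [σ, hc])
      have h₂ : j.succ = σ ⟨i + 1, by omega⟩ :=
        Fin.ext (by simp [σ, jumpCount_succ_of_isJump hp, hc])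
      simp only [Function.comp_apply]
      rw [h₁, h₂, hfac, hfac]
      exact hp.2
    · exact funext fun i ↦ (hfac i).symm
  · have last {m : ℕ} {σ : Fin (k + 1) → Fin (m + 1)} {h : Fin (m + 1) → I} (hσ : Monotone σ)
        (hs : Function.Surjective σ) (hh : ∀ j : Fin m, h j.castSucc ≠ h j.succ)
        (hf : f = h ∘ σ) : m = jumpCount f k := by
      rw [← val_eq_jumpCount hσ hs hh hf k (by omega)]
      obtain ⟨a, ha⟩ := hs (Fin.last m)
      have hle : σ a ≤ σ ⟨k, by omega⟩ := hσ (Fin.le_last a)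
      rw [ha, Fin.last_le_iff] at hle
      simp [hle]
    rintro ⟨m, σ, h⟩ ⟨m', σ', h'⟩ ⟨-, hσ, hs, hh, hf⟩ ⟨-, hσ', hs', hh', hf'⟩
    simp only at hσ hs hh hf hσ' hs' hh' hf'
    obtain rfl : m = m' := (last hσ hs hh hf).trans (last hσ' hs' hh' hf').symm
    obtain rfl : σ = σ' := funext fun i ↦ Fin.ext <|
      (val_eq_jumpCount hσ hs hh hf i i.2).trans (val_eq_jumpCount hσ' hs' hh' hf' i i.2).symm
    obtain rfl : h = h' := hs.injective_comp_right (hf.symm.trans hf')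
    rfl
end

section
/- Let J be a small category, let C be a category, and let D be a category having colimits of shape J. Let F, G : C ⥤ D be functors and suppose F is a retract of G in the functor category: there are natural transformations ι : F ⟶ G and ρ : G ⟶ F with ι ≫ ρ equal to the identity of F. If G preserves colimits of shape J, then F preserves colimits of shape J. -/
open CategoryTheory Limits

/-- If a functor `F` is a retract (in the functor category) of a functor `G` that
preserves colimits of shape `J`, and `D` has colimits of shape `J`, then `F` preserves
colimits of shape `J`. -/
theorem stmt9 {J : Type*} [SmallCategory J] {C D : Type*} [Category C] [Category D]
    [HasColimitsOfShape J D] (F G : C ⥤ D) (ι : F ⟶ G) (ρ : G ⟶ F) (hρι : ι ≫ ρ = 𝟙 F)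
    [PreservesColimitsOfShape J G] : PreservesColimitsOfShape J F := by
  have retract_app (X : C) {Y : D} (f : F.obj X ⟶ Y) : ι.app X ≫ ρ.app X ≫ f = f := by
    rw [← Category.assoc, ← NatTrans.comp_app, hρι, NatTrans.id_app, Category.id_comp]
  refine ⟨fun {K} ↦ ⟨fun {c} hc ↦ ⟨?_⟩⟩⟩
  have hG : IsColimit (G.mapCocone c) := isColimitOfPreserves G hc
  let pulledBack (s : Cocone (K ⋙ F)) : Cocone (K ⋙ G) :=
    (Cocone.precompose (Functor.whiskerLeft K ρ)).obj s
  refine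
    { desc := fun s ↦ ι.app c.pt ≫ hG.desc (pulledBack s)
      fac := fun s j ↦ ?_
      uniq := fun s m hm ↦ ?_ }
  · have fac : G.map (c.ι.app j) ≫ hG.desc (pulledBack s) = ρ.app (K.obj j) ≫ s.ι.app j :=
      hG.fac (pulledBack s) j
    exact (ι.naturality_assoc (c.ι.app j) _).trans
      ((congrArg (ι.app (K.obj j) ≫ ·) fac).trans (retract_app _ _))
  · have hm' : ρ.app c.pt ≫ m = hG.desc (pulledBack s) := by
      refine hG.uniq (pulledBack s) _ fun j ↦ ?_
      exact (ρ.naturality_assoc (c.ι.app j) m).trans (congrArg (ρ.app (K.obj j) ≫ ·) (hm j))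
    rw [← hm']
    exact (retract_app _ m).symm
end
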